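/- Let 𝔤 be a finite-dimensional real Lie algebra of compact type, i.e. 𝔤 admits an ad-invariant (bi-invariant) inner product. Then the inclusion of the subcomplex of ad*-invariant forms ((Λ•𝔤*)^{ad*}, d_CE) into the full Chevalley–Eilenberg complex (Λ•𝔤*, d_CE) is a quasi-isomorphism; in particular, the Lie algebra cohomology H•(𝔤) is computed by the subcomplex of ad*-invariant forms. -/

import Mathlib

/-!
Formalization of statements from:
"A Transverse Averaging Operator and Cohomology of Quotients by Non-closed Subgroups".

Since Mathlib does not yet contain differential forms on manifolds, foliations,
Riemannian foliations, or diffeological spaces, the geometric notions appearing in the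
paper are formalized here from first principles (raw multilinear cochains, a concrete
theory of diffeological spaces and diffeological differential forms, synthetic
(diffeological) Lie groups given by a Maurer–Cartan parallelism, etc.).
-/

noncomputable section

open scoped BigOperators

namespace Paper

/-- A real-valued function of `k` vector arguments is alternating multilinear.
This encodes an element of `Λᵏ M*`. -/
def IsAltML {M : Type*} [AddCommGroup M] [Module ℝ M] (k : ℕ) (η : (Fin k → M) → ℝ) : Prop :=
  (∀ (v : Fin k → M) (i : Fin k) (a : ℝ) (x y : M),
      η (Function.update v i (a • x + y)) =
        a * η (Function.update v i x) + η (Function.update v i y)) ∧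
  (∀ (v : Fin k → M) (i j : Fin k), i ≠ j → v i = v j → η v = 0)

/-- Auxiliary index map: the strictly monotone map `Fin (k-1) → Fin (k+1)` (at the level
of natural numbers) skipping the two indices `i < j`. -/
def skip2 (i j m : ℕ) : ℕ := if m < i then m else if m + 1 < j then m + 1 else m + 2

/-- The argument vector `(⁅ξ i, ξ j⁆, ξ 0, …, ξ̂ i, …, ξ̂ j, …, ξ k)` appearing in the
Chevalley–Eilenberg differential. -/
def dceArg {L : Type*} [LieRing L] {k : ℕ} (ξ : Fin (k + 1) → L) (i j : Fin (k + 1)) :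
    Fin k → L := fun t =>
  if ht0 : (t : ℕ) = 0 then ⁅ξ i, ξ j⁆
  else ξ ⟨skip2 (i : ℕ) (j : ℕ) ((t : ℕ) - 1), by
    have ht := t.isLt
    unfold skip2; split_ifs <;> omega⟩

/-- The Chevalley–Eilenberg differential on raw `k`-cochains:
`(d_CE η)(ξ₀,…,ξ_k) = ∑_{i<j} (−1)^{i+j} η(⁅ξ_i,ξ_j⁆, ξ₀,…,ξ̂_i,…,ξ̂_j,…,ξ_k)`. -/
def dCE {L : Type*} [LieRing L] (k : ℕ) (η : (Fin k → L) → ℝ) :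
    (Fin (k + 1) → L) → ℝ := fun ξ =>
  ∑ i : Fin (k + 1), ∑ j : Fin (k + 1),
    if (i : ℕ) < (j : ℕ) then (-1 : ℝ) ^ ((i : ℕ) + (j : ℕ)) * η (dceArg ξ i j) else 0

/-- The coadjoint action on raw `k`-cochains:
`(ad*(x) η)(Y₁,…,Y_k) = −∑_i η(Y₁,…,⁅x,Y_i⁆,…,Y_k)`. -/
def adStar {L : Type*} [LieRing L] (k : ℕ) (x : L) (η : (Fin k → L) → ℝ) :
    (Fin k → L) → ℝ := fun v => -∑ i : Fin k, η (Function.update v i ⁅x, v i⁆)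

/-- Contraction of a `(k+1)`-cochain with `x` in the first slot. -/
def iotaCE {L : Type*} [LieRing L] (k : ℕ) (x : L) (η : (Fin (k + 1) → L) → ℝ) :
    (Fin k → L) → ℝ := fun v => η (Fin.cons x v)

/-- `ι_x η = 0` for every `x` in the set `s` (no condition in degree `0`). -/
def IotaVanishes {L : Type*} [LieRing L] (s : Set L) : ∀ k : ℕ, ((Fin k → L) → ℝ) → Prop
  | 0, _ => True
  | (k + 1), η => ∀ x ∈ s, iotaCE k x η = 0

/-- Membership in the relative Chevalley–Eilenberg complex `C•_CE(𝔤,𝔥)`: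
`ι_X η = 0` and `ad*(X) η = 0` for all `X ∈ 𝔥`. -/
def IsRelCE {L : Type*} [LieRing L] (s : Set L) (k : ℕ) (η : (Fin k → L) → ℝ) : Prop :=
  IotaVanishes s k η ∧ ∀ x ∈ s, adStar k x η = 0

/-- `ad*`-invariance of a cochain. -/
def IsAdInvariant {L : Type*} [LieRing L] (k : ℕ) (η : (Fin k → L) → ℝ) : Prop :=
  ∀ x : L, adStar k x η = 0

/-- A real Lie algebra is of compact type if it admits an ad-invariant (bi-invariant)
inner product. -/
def IsCompactType (L : Type*) [LieRing L] [LieAlgebra ℝ L] : Prop :=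
  ∃ B : L →ₗ[ℝ] L →ₗ[ℝ] ℝ, (∀ x y, B x y = B y x) ∧ (∀ x, x ≠ 0 → 0 < B x x) ∧
    ∀ x y z : L, B ⁅x, y⁆ z + B y ⁅x, z⁆ = 0

section RawCochains

variable {M : Type*} {k n : ℕ}

/-- Restriction of cochains to tuples of vectors taken from the family `e`. -/
def evalBasis {ι : Type*} (e : ι → M) (k : ℕ) : ((Fin k → M) → ℝ) →ₗ[ℝ] ((Fin k → ι) → ℝ) where
  toFun η := fun f => η (e ∘ f)
  map_add' _ _ := rfl
  map_smul' _ _ := rfl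

/-- Contraction with `x` in the first slot, as a linear map. -/
def contr (k : ℕ) (x : M) : ((Fin (k + 1) → M) → ℝ) →ₗ[ℝ] ((Fin k → M) → ℝ) where
  toFun η := fun v => η (Fin.cons x v)
  map_add' _ _ := rfl
  map_smul' _ _ := rfl

lemma contr_apply (x : M) (η : (Fin (k + 1) → M) → ℝ) (v : Fin k → M) :
    contr k x η v = η (Fin.cons x v) := rfl

lemma ext_contr {η θ : (Fin (k + 1) → M) → ℝ} (h : ∀ x, contr k x η = contr k x θ) : η = θ := by
  funext v
  simpa [contr_apply, Fin.cons_self_tail] using congrFun (h (v 0)) (Fin.tail v)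

lemma cons_mk_of_eq_succ (x : M) (v : Fin k → M) {n m : ℕ} (hn : n < k + 1)
    (h : n = m + 1) : (Fin.cons x v : Fin (k + 1) → M) ⟨n, hn⟩ = v ⟨m, by omega⟩ := by
  subst h; rfl

/-- The pairing of cochains given by summing over all tuples from the family `e`. -/
def pairing (e : Fin n → M) (η θ : (Fin k → M) → ℝ) : ℝ :=
  ∑ f : Fin k → Fin n, η (e ∘ f) * θ (e ∘ f)

lemma pairing_self_nonneg (e : Fin n → M) (η : (Fin k → M) → ℝ) : 0 ≤ pairing e η η :=
  Finset.sum_nonneg fun _ _ => mul_self_nonneg _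

lemma pairing_sum_left (e : Fin n → M) {ι : Type*} (s : Finset ι) (η : ι → (Fin k → M) → ℝ)
    (θ : (Fin k → M) → ℝ) : pairing e (∑ a ∈ s, η a) θ = ∑ a ∈ s, pairing e (η a) θ := by
  simp only [pairing, Finset.sum_apply, Finset.sum_mul]
  exact Finset.sum_comm

lemma pairing_sum_right (e : Fin n → M) {ι : Type*} (s : Finset ι) (η : (Fin k → M) → ℝ)
    (θ : ι → (Fin k → M) → ℝ) : pairing e η (∑ a ∈ s, θ a) = ∑ a ∈ s, pairing e η (θ a) := by
  simp only [pairing, Finset.sum_apply, Finset.mul_sum]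
  exact Finset.sum_comm

end RawCochains

section Cochains

variable {M : Type*} [AddCommGroup M] [Module ℝ M] {k : ℕ}

/-- An alternating cochain, viewed as an alternating map. -/
def IsAltML.toAlternatingMap {η : (Fin k → M) → ℝ} (h : IsAltML k η) : M [⋀^Fin k]→ₗ[ℝ] ℝ where
  toFun := η
  map_update_add' := by
    intro inst v i x y
    obtain rfl := Subsingleton.elim inst (instDecidableEqFin k)
    simpa using h.1 v i 1 x y
  map_update_smul' := by
    intro inst v i a x
    obtain rfl := Subsingleton.elim inst (instDecidableEqFin k)
    have h0 : η (Function.update v i 0) = 0 := by simpa using h.1 v i 1 0 0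
    simpa [h0] using h.1 v i a x 0
  map_eq_zero_of_eq' := fun v i j hv hij => h.2 v i j hij hv

@[simp]
lemma IsAltML.coe_toAlternatingMap {η : (Fin k → M) → ℝ} (h : IsAltML k η) :
    ⇑h.toAlternatingMap = η := rfl

/-- The space of alternating multilinear `k`-cochains. -/
def altForms (M : Type*) [AddCommGroup M] [Module ℝ M] (k : ℕ) :
    Submodule ℝ ((Fin k → M) → ℝ) where
  carrier := {η | IsAltML k η}
  add_mem' := by
    rintro η θ ⟨h₁, h₂⟩ ⟨h₃, h₄⟩
    refine ⟨fun v i a x y => ?_, fun v i j hij hv => ?_⟩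
    · simp only [Pi.add_apply, h₁, h₃]; ring
    · simp [h₂ v i j hij hv, h₄ v i j hij hv]
  zero_mem' := ⟨by simp, by simp⟩
  smul_mem' := by
    rintro c η ⟨h₁, h₂⟩
    refine ⟨fun v i a x y => ?_, fun v i j hij hv => ?_⟩
    · simp only [Pi.smul_apply, smul_eq_mul, h₁]; ring
    · simp [h₂ v i j hij hv]

lemma mem_altForms {η : (Fin k → M) → ℝ} : η ∈ altForms M k ↔ IsAltML k η := Iff.rfl

lemma eq_zero_of_evalBasis_eq_zero {ι : Type*} (e : Module.Basis ι ℝ M)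
    {η : (Fin k → M) → ℝ} (h : IsAltML k η) (h0 : evalBasis e k η = 0) : η = 0 := by
  have : h.toAlternatingMap.toMultilinearMap = 0 :=
    Module.Basis.ext_multilinear (fun _ => e) fun f => congrFun h0 f
  exact congrArg (fun f : MultilinearMap ℝ (fun _ : Fin k => M) ℝ => ⇑f) this

instance [FiniteDimensional ℝ M] : FiniteDimensional ℝ (altForms M k) := by
  let e := Module.finBasis ℝ M
  refine Module.Finite.of_injective ((evalBasis e k).comp (altForms M k).subtype) ?_
  rw [← LinearMap.ker_eq_bot, LinearMap.ker_eq_bot']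
  exact fun η h => Subtype.ext (eq_zero_of_evalBasis_eq_zero e η.2 h)

lemma contr_mem {η : (Fin (k + 1) → M) → ℝ} (h : η ∈ altForms M (k + 1)) (x : M) :
    contr k x η ∈ altForms M k := by
  refine ⟨fun v i a y z => ?_, fun v i j hij hv => ?_⟩
  · simp only [contr_apply, Fin.cons_update]; exact h.1 _ _ _ _ _
  · exact h.2 _ i.succ j.succ (by simpa using hij) (by simpa using hv)

lemma contr_smul_add {η : (Fin (k + 1) → M) → ℝ} (h : η ∈ altForms M (k + 1)) (a : ℝ) (x y : M) :
    contr k (a • x + y) η = a • contr k x η + contr k y η := by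
  funext v
  have := h.1 (Fin.cons x v) 0 a x y
  simp only [Fin.update_cons_zero] at this
  exact this

lemma contr_add {η : (Fin (k + 1) → M) → ℝ} (h : η ∈ altForms M (k + 1)) (x y : M) :
    contr k (x + y) η = contr k x η + contr k y η := by
  simpa using contr_smul_add h 1 x y

lemma contr_contr_self {η : (Fin (k + 2) → M) → ℝ} (h : η ∈ altForms M (k + 2)) (x : M) :
    contr k x (contr (k + 1) x η) = 0 := by
  funext v
  exact h.2 _ 0 1 (by simp) rfl

lemma contr_contr_swap {η : (Fin (k + 2) → M) → ℝ} (h : η ∈ altForms M (k + 2)) (x y : M) :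
    contr k x (contr (k + 1) y η) = -contr k y (contr (k + 1) x η) := by
  have := contr_contr_self h (x + y)
  rw [contr_add h, map_add, contr_add (contr_mem h x), contr_add (contr_mem h y),
    contr_contr_self h, contr_contr_self h] at this
  rw [eq_neg_iff_add_eq_zero, ← this]
  abel

lemma mem_altForms_one {η : (Fin 1 → M) → ℝ}
    (h : ∀ (a : ℝ) (x y : M), contr 0 (a • x + y) η = a • contr 0 x η + contr 0 y η) :
    η ∈ altForms M 1 := by
  refine ⟨fun v i a x y => ?_, fun v i j hij => absurd (Subsingleton.elim i j) hij⟩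
  obtain rfl := Subsingleton.elim 0 i
  rw [← Fin.cons_self_tail v]
  simp only [Fin.update_cons_zero]
  exact congrFun (h a x y) _

lemma mem_altForms_add_two {η : (Fin (k + 2) → M) → ℝ}
    (h₁ : ∀ x, contr (k + 1) x η ∈ altForms M (k + 1))
    (h₂ : ∀ (a : ℝ) (x y : M),
      contr (k + 1) (a • x + y) η = a • contr (k + 1) x η + contr (k + 1) y η)
    (h₃ : ∀ x, contr k x (contr (k + 1) x η) = 0) :
    η ∈ altForms M (k + 2) := by
  have key : ∀ (x : M) (v : Fin (k + 1) → M) (j : Fin (k + 1)), v j = x →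
      η (Fin.cons x v) = 0 := by
    intro x v j hj
    have h0 : ∀ w : Fin (k + 1) → M, w 0 = x → η (Fin.cons x w) = 0 := by
      intro w hw
      have := congrFun (h₃ x) (Fin.tail w)
      rw [contr_apply, contr_apply, ← hw, Fin.cons_self_tail] at this
      rw [← hw]; exact this
    by_cases hj0 : j = 0
    · exact h0 v (hj0 ▸ hj)
    · have hs := (mem_altForms.1 (h₁ x)).toAlternatingMap.map_swap v (i := 0) (j := j) (Ne.symm hj0)
      simp only [IsAltML.coe_toAlternatingMap, contr_apply] at hs
      rw [h0 _ (by simp [hj])] at hs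
      linarith
  refine ⟨fun v i a x y => ?_, ?_⟩
  · rw [← Fin.cons_self_tail v]
    induction i using Fin.cases with
    | zero =>
      simp only [Fin.update_cons_zero]
      exact congrFun (h₂ a x y) _
    | succ i =>
      simp only [← Fin.cons_update]
      exact (h₁ (v 0)).1 _ _ _ _ _
  · intro v i j hij hv
    rw [← Fin.cons_self_tail v]
    induction i using Fin.cases with
    | zero =>
      induction j using Fin.cases with
      | zero => exact absurd rfl hij
      | succ j => exact key _ _ j hv.symm
    | succ i =>
      induction j using Fin.cases with
      | zero => exact key _ _ i hv
      | succ j => exact (h₁ (v 0)).2 _ i j (by simpa using hij) hv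

end Cochains

section Cartan

variable {L : Type*} [LieRing L] {k n : ℕ}

/-- The coadjoint action on cochains, as a linear map. -/
def lieDer (k : ℕ) (x : L) : ((Fin k → L) → ℝ) →ₗ[ℝ] ((Fin k → L) → ℝ) where
  toFun := adStar k x
  map_add' η θ := by
    funext v
    simp only [adStar, Pi.add_apply, Finset.sum_add_distrib]; ring
  map_smul' c η := by
    funext v
    simp [adStar, Finset.mul_sum]

/-- The Chevalley–Eilenberg differential on cochains, as a linear map. -/
def dLin (L : Type*) [LieRing L] (k : ℕ) : ((Fin k → L) → ℝ) →ₗ[ℝ] ((Fin (k + 1) → L) → ℝ) where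
  toFun := dCE k
  map_add' η θ := by
    funext v
    simp only [dCE, Pi.add_apply, ← Finset.sum_add_distrib]
    refine Finset.sum_congr rfl fun i _ => Finset.sum_congr rfl fun j _ => ?_
    split_ifs <;> ring
  map_smul' c η := by
    funext v
    simp only [dCE, Pi.smul_apply, smul_eq_mul, RingHom.id_apply, Finset.mul_sum]
    refine Finset.sum_congr rfl fun i _ => Finset.sum_congr rfl fun j _ => ?_
    split_ifs <;> ring

lemma lieDer_zero_deg (x : L) (η : (Fin 0 → L) → ℝ) : lieDer 0 x η = 0 := by
  funext v; simp [lieDer, adStar]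

lemma dLin_zero_deg (η : (Fin 0 → L) → ℝ) : dLin L 0 η = 0 := by
  funext v; simp [dLin, dCE]

lemma contr_lieDer (x z : L) (η : (Fin (k + 1) → L) → ℝ) :
    contr k z (lieDer (k + 1) x η) = lieDer k x (contr k z η) - contr k ⁅x, z⁆ η := by
  funext v
  simp only [contr_apply, Pi.sub_apply]
  change -_ = -_ - _
  rw [Fin.sum_univ_succ]
  simp only [Fin.cons_zero, Fin.cons_succ, Fin.update_cons_zero, ← Fin.cons_update, contr_apply]
  ring

/-- The operator `∑ₐ ad*(eₐ)²` on cochains. -/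
def casimir (e : Fin n → L) (k : ℕ) : ((Fin k → L) → ℝ) →ₗ[ℝ] ((Fin k → L) → ℝ) :=
  ∑ a, lieDer k (e a) ∘ₗ lieDer k (e a)

lemma casimir_apply (e : Fin n → L) (η : (Fin k → L) → ℝ) :
    casimir e k η = ∑ a, lieDer k (e a) (lieDer k (e a) η) := by
  simp [casimir, LinearMap.sum_apply]

lemma IsAdInvariant.casimir_eq_zero {e : Fin n → L} {η : (Fin k → L) → ℝ}
    (h : IsAdInvariant k η) : casimir e k η = 0 := by
  rw [casimir_apply]
  refine Finset.sum_eq_zero fun a _ => ?_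
  rw [show lieDer k (e a) η = 0 from h (e a), map_zero]

lemma dceArg_cons_zero (x : L) (v : Fin (k + 1) → L) (j : Fin (k + 1)) :
    dceArg (Fin.cons x v : Fin (k + 2) → L) 0 j.succ =
      Fin.cons ⁅x, v j⁆ (fun i => v (j.succAbove i)) := by
  funext t
  induction t using Fin.cases with
  | zero => simp [dceArg]
  | succ t =>
    simp only [dceArg, Fin.val_succ, Nat.add_eq_zero_iff, one_ne_zero, and_false, dite_false,
      Fin.cons_succ]
    have hval : skip2 ((0 : Fin (k + 2)) : ℕ) (j + 1) (t + 1 - 1) = j.succAbove t + 1 := by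
      rw [Fin.val_zero, skip2, if_neg (Nat.not_lt_zero _), Nat.add_sub_cancel]
      simp only [Fin.succAbove, Fin.lt_def, Fin.val_castSucc, Nat.add_lt_add_iff_right]
      split_ifs <;> simp
    exact cons_mk_of_eq_succ x v _ hval

variable [LieAlgebra ℝ L]

lemma contr_self_lieDer_self (x : L) (η : (Fin (k + 1) → L) → ℝ) (h : η ∈ altForms L (k + 1)) :
    contr k x (lieDer (k + 1) x η) = lieDer k x (contr k x η) := by
  have h0 : contr k (0 : L) η = 0 := by simpa using contr_add h 0 0
  rw [contr_lieDer, lie_self, h0, sub_zero]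

lemma lieDer_smul_add {η : (Fin k → L) → ℝ} (h : η ∈ altForms L k) (a : ℝ) (x y : L) :
    lieDer k (a • x + y) η = a • lieDer k x η + lieDer k y η := by
  funext v
  change -_ = a * -_ + -_
  simp only [add_lie, smul_lie, h.1, Finset.sum_add_distrib, ← Finset.mul_sum]
  ring

lemma lieDer_mem {η : (Fin k → L) → ℝ} (h : η ∈ altForms L k) (x : L) :
    lieDer k x η ∈ altForms L k := by
  induction k with
  | zero => rw [lieDer_zero_deg]; exact zero_mem _
  | succ k ih =>
    have h₂ : ∀ (a : ℝ) (y z : L), contr k (a • y + z) (lieDer (k + 1) x η) =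
        a • contr k y (lieDer (k + 1) x η) + contr k z (lieDer (k + 1) x η) := by
      intro a y z
      simp only [contr_lieDer, lie_add, lie_smul, contr_smul_add h, map_add, map_smul, smul_sub]
      abel
    cases k with
    | zero => exact mem_altForms_one h₂
    | succ k =>
      refine mem_altForms_add_two (fun z => ?_) h₂ fun z => ?_
      · rw [contr_lieDer]
        exact sub_mem (ih (contr_mem h z)) (contr_mem h _)
      · rw [contr_lieDer, map_sub, contr_lieDer, contr_contr_self h, map_zero,
          contr_contr_swap h z, zero_sub, sub_neg_eq_add, neg_add_cancel]

lemma lieDer_lie {η : (Fin k → L) → ℝ} (h : η ∈ altForms L k) (x y : L) :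
    lieDer k x (lieDer k y η) - lieDer k y (lieDer k x η) = lieDer k ⁅x, y⁆ η := by
  induction k with
  | zero => simp [lieDer_zero_deg]
  | succ k ih =>
    refine ext_contr fun z => ?_
    have e : contr k ⁅x, ⁅y, z⁆⁆ η = contr k ⁅⁅x, y⁆, z⁆ η + contr k ⁅y, ⁅x, z⁆⁆ η := by
      rw [← contr_add h, ← leibniz_lie]
    rw [map_sub, contr_lieDer, contr_lieDer, contr_lieDer y z, contr_lieDer x z, contr_lieDer,
      contr_lieDer, contr_lieDer, map_sub, map_sub, ← ih (contr_mem h z), e]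
    abel

lemma map_cons_succAbove {η : (Fin (k + 1) → L) → ℝ} (h : η ∈ altForms L (k + 1)) (y : L)
    (v : Fin (k + 1) → L) (m : Fin (k + 1)) :
    η (Fin.cons y (fun i => v (m.succAbove i))) = (-1) ^ (m : ℕ) * η (Function.update v m y) := by
  have := (mem_altForms.1 h).toAlternatingMap.map_insertNth m y (m.removeNth v)
  rw [Fin.insertNth_removeNth] at this
  simp only [IsAltML.coe_toAlternatingMap, zsmul_eq_mul] at this
  rw [this]
  rw [← mul_assoc]
  simp only [Int.cast_pow, Int.cast_neg, Int.cast_one, ← mul_pow, mul_neg, mul_one, neg_neg,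
    one_pow, one_mul]
  rfl

lemma dceArg_cons_succ {η : (Fin (k + 1) → L) → ℝ} (h : η ∈ altForms L (k + 1)) (x : L)
    (v : Fin (k + 1) → L) {i j : Fin (k + 1)} (hij : (i : ℕ) < j) :
    η (dceArg (Fin.cons x v : Fin (k + 2) → L) i.succ j.succ) =
      -η (Fin.cons x (dceArg v i j)) := by
  obtain _ | k := k
  · omega
  have hs := (mem_altForms.1 h).toAlternatingMap.map_swap (Fin.cons x (dceArg v i j)) (i := 0) (j := 1)
    (by simp)
  simp only [IsAltML.coe_toAlternatingMap] at hs
  rw [← hs]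
  congr 1
  funext t
  induction t using Fin.cases with
  | zero => simp [dceArg]
  | succ t =>
    induction t using Fin.cases with
    | zero => simp [dceArg, skip2]
    | succ t =>
      have : Equiv.swap (0 : Fin (k + 2)) 1 t.succ.succ = t.succ.succ :=
        Equiv.swap_apply_of_ne_of_ne (by simp) (by simp [Fin.ext_iff])
      simp only [Function.comp_apply, this, Fin.cons_succ]
      have hval : skip2 (i + 1) (j + 1) (t + 1 + 1 - 1) = skip2 i j (t + 1 - 1) + 1 := by
        simp only [skip2]
        split_ifs <;> omega
      simp only [dceArg, Fin.val_succ, Nat.add_eq_zero_iff, one_ne_zero, and_false, dite_false]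
      exact cons_mk_of_eq_succ x v _ hval

/-- Cartan's formula. -/
lemma contr_dLin {η : (Fin (k + 1) → L) → ℝ} (h : η ∈ altForms L (k + 1)) (x : L) :
    contr (k + 1) x (dLin L (k + 1) η) = lieDer (k + 1) x η - dLin L k (contr k x η) := by
  funext v
  rw [contr_apply, Pi.sub_apply]
  change dCE (k + 1) η _ = adStar (k + 1) x η v - dCE k (contr k x η) v
  simp only [dCE, adStar]
  rw [Fin.sum_univ_succ, sub_eq_add_neg, ← Finset.sum_neg_distrib, ← Finset.sum_neg_distrib]
  congr 1
  · rw [Fin.sum_univ_succ]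
    simp only [Fin.val_zero, lt_irrefl, if_false, zero_add, Fin.val_succ, Nat.succ_pos, if_true]
    refine Finset.sum_congr rfl fun j _ => ?_
    rw [dceArg_cons_zero, map_cons_succAbove h, ← mul_assoc, ← pow_add,
      show (j : ℕ) + 1 + j = 2 * j + 1 by ring, pow_succ, pow_mul]
    simp
  · refine Finset.sum_congr rfl fun i _ => ?_
    rw [Fin.sum_univ_succ, ← Finset.sum_neg_distrib]
    simp only [Fin.val_zero, Fin.val_succ, Nat.not_lt_zero, if_false, zero_add,
      Nat.add_lt_add_iff_right]
    refine Finset.sum_congr rfl fun j _ => ?_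
    split_ifs with hij
    · rw [dceArg_cons_succ h x v hij, contr_apply,
        show (i : ℕ) + 1 + (j + 1) = (i + j) + 2 by ring, pow_add]
      simp
    · simp

lemma dLin_mem {η : (Fin k → L) → ℝ} (h : η ∈ altForms L k) :
    dLin L k η ∈ altForms L (k + 1) := by
  induction k with
  | zero => rw [dLin_zero_deg]; exact zero_mem _
  | succ k ih =>
    refine mem_altForms_add_two (fun x => ?_) (fun a x y => ?_) fun x => ?_
    · rw [contr_dLin h]
      exact sub_mem (lieDer_mem h x) (ih (contr_mem h x))
    · simp only [contr_dLin h, contr_smul_add h, lieDer_smul_add h, map_add, map_smul, smul_sub]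
      abel
    · rw [contr_dLin h, map_sub, contr_self_lieDer_self x η h]
      cases k with
      | zero => simp [lieDer_zero_deg, dLin_zero_deg]
      | succ k => rw [contr_dLin (contr_mem h x), contr_contr_self h, map_zero, sub_zero, sub_self]

lemma dLin_lieDer {η : (Fin k → L) → ℝ} (h : η ∈ altForms L k) (x : L) :
    dLin L k (lieDer k x η) = lieDer (k + 1) x (dLin L k η) := by
  induction k with
  | zero => simp [lieDer_zero_deg, dLin_zero_deg]
  | succ k ih =>
    refine ext_contr fun y => ?_
    rw [contr_dLin (lieDer_mem h x), contr_lieDer, contr_lieDer, contr_dLin h, contr_dLin h,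
      map_sub, map_sub, ih (contr_mem h y), ← lieDer_lie h]
    abel

end Cartan

section Casimir

variable {L : Type*} [LieRing L] [LieAlgebra ℝ L] {k n : ℕ}

lemma IsCompactType.exists_basis [FiniteDimensional ℝ L] (hct : IsCompactType L) :
    ∃ (n : ℕ) (e : Module.Basis (Fin n) ℝ L),
      ∀ (x : L) (a b : Fin n), e.repr ⁅x, e a⁆ b = -e.repr ⁅x, e b⁆ a := by
  obtain ⟨B, hsymm, hpos, hinv⟩ := hct
  let core : InnerProductSpace.Core ℝ L :=
    { inner := fun x y => B x y
      conj_inner_symm := fun x y => hsymm y x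
      re_inner_nonneg := fun x => by
        by_cases hx : x = 0
        · simp [hx]
        · exact (hpos x hx).le
      add_left := fun x y z => by simp
      smul_left := fun x y r => by simp
      definite := fun x hx => by
        by_contra h
        exact (hpos x h).ne' hx }
  let : NormedAddCommGroup L := core.toNormedAddCommGroup
  let : InnerProductSpace ℝ L := .ofCore core.toCore
  let e := stdOrthonormalBasis ℝ L
  refine ⟨_, e.toBasis, fun x a b => ?_⟩
  simp only [OrthonormalBasis.coe_toBasis_repr_apply, OrthonormalBasis.coe_toBasis,
    OrthonormalBasis.repr_apply_apply]
  change B (e b) ⁅x, e a⁆ = -B (e a) ⁅x, e b⁆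
  have := hinv x (e b) (e a)
  rw [hsymm ⁅x, e b⁆] at this
  linarith

lemma eq_zero_of_pairing_self_nonpos (e : Module.Basis (Fin n) ℝ L) {η : (Fin k → L) → ℝ}
    (h : η ∈ altForms L k) (h0 : pairing e η η ≤ 0) : η = 0 := by
  refine eq_zero_of_evalBasis_eq_zero e h ?_
  have h1 : pairing e η η = 0 :=
    le_antisymm h0 (pairing_self_nonneg _ _)
  funext f
  have := (Finset.sum_eq_zero_iff_of_nonneg fun f _ => mul_self_nonneg _).1 h1 f (Finset.mem_univ f)
  exact mul_self_eq_zero.1 this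

lemma map_update_lie (e : Module.Basis (Fin n) ℝ L) {η : (Fin k → L) → ℝ}
    (h : η ∈ altForms L k) (x : L) (f : Fin k → Fin n) (i : Fin k) :
    η (Function.update (e ∘ f) i ⁅x, e (f i)⁆) =
      ∑ b, e.repr ⁅x, e (f i)⁆ b * η (e ∘ Function.update f i b) := by
  conv_lhs => rw [← e.sum_repr ⁅x, e (f i)⁆]
  have := (mem_altForms.1 h).toAlternatingMap.map_update_sum Finset.univ i
    (fun b => e.repr ⁅x, e (f i)⁆ b • e b) (e ∘ f)
  rw [IsAltML.coe_toAlternatingMap] at this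
  rw [this]
  refine Finset.sum_congr rfl fun b _ => ?_
  have := (mem_altForms.1 h).toAlternatingMap.map_update_smul (e ∘ f) i (e.repr ⁅x, e (f i)⁆ b) (e b)
  rw [IsAltML.coe_toAlternatingMap] at this
  rw [this, smul_eq_mul, Function.comp_update]

lemma pairing_lieDer (e : Module.Basis (Fin n) ℝ L)
    (he : ∀ (x : L) (a b : Fin n), e.repr ⁅x, e a⁆ b = -e.repr ⁅x, e b⁆ a) {η θ : (Fin k → L) → ℝ}
    (hη : η ∈ altForms L k) (hθ : θ ∈ altForms L k) (x : L) :
    pairing e (lieDer k x η) θ = -pairing e η (lieDer k x θ) := by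
  have key : ∀ {η θ : (Fin k → L) → ℝ}, η ∈ altForms L k →
      pairing e (lieDer k x η) θ = -∑ i, ∑ p : (Fin k → Fin n) × Fin n,
        e.repr ⁅x, e (p.1 i)⁆ p.2 * η (e ∘ Function.update p.1 i p.2) * θ (e ∘ p.1) := by
    intro η θ h
    simp only [pairing, lieDer, LinearMap.coe_mk, AddHom.coe_mk, adStar, Function.comp_apply,
      map_update_lie e h, Fintype.sum_prod_type, neg_mul, Finset.sum_mul, Finset.sum_neg_distrib]
    rw [Finset.sum_comm]
  have comm : pairing e η (lieDer k x θ) = pairing e (lieDer k x θ) η :=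
    Finset.sum_congr rfl fun f _ => mul_comm _ _
  rw [comm, key hη, key hθ, ← Finset.sum_neg_distrib, neg_neg]
  refine Finset.sum_congr rfl fun i _ => ?_
  rw [← Finset.sum_neg_distrib]
  let s : (Fin k → Fin n) × Fin n → (Fin k → Fin n) × Fin n :=
    fun p => (Function.update p.1 i p.2, p.1 i)
  have hs : Function.Involutive s := fun p => by simp [s]
  rw [← Equiv.sum_comp (hs.toPerm s)]
  refine Finset.sum_congr rfl fun p _ => ?_
  simp only [Function.Involutive.coe_toPerm, s, Function.update_self, Function.update_idem,
    Function.update_eq_self]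
  rw [he]
  ring

lemma casimir_mem (e : Fin n → L) {η : (Fin k → L) → ℝ} (h : η ∈ altForms L k) :
    casimir e k η ∈ altForms L k := by
  rw [casimir_apply]
  exact sum_mem fun a _ => lieDer_mem (lieDer_mem h _) _

lemma isAdInvariant_of_forall_basis (e : Module.Basis (Fin n) ℝ L) {η : (Fin k → L) → ℝ}
    (h : η ∈ altForms L k) (h0 : ∀ a, lieDer k (e a) η = 0) : IsAdInvariant k η := by
  let φ : L →ₗ[ℝ] ((Fin k → L) → ℝ) := IsLinearMap.mk' (fun x => lieDer k x η)
    { map_add := fun x y => by simpa using lieDer_smul_add h 1 x y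
      map_smul := fun a x => by
        have h1 : lieDer k (0 : L) η = 0 := by simpa using lieDer_smul_add h 1 0 0
        simpa [h1] using lieDer_smul_add h a x 0 }
  have : φ = 0 := e.ext h0
  exact fun x => LinearMap.congr_fun this x

lemma isAdInvariant_of_casimir_eq_zero (e : Module.Basis (Fin n) ℝ L)
    (he : ∀ (x : L) (a b : Fin n), e.repr ⁅x, e a⁆ b = -e.repr ⁅x, e b⁆ a) {η : (Fin k → L) → ℝ}
    (h : η ∈ altForms L k) (h0 : casimir e k η = 0) : IsAdInvariant k η := by
  have h1 : pairing e (casimir e k η) η = 0 := by simp [h0, pairing]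
  rw [casimir_apply, pairing_sum_left] at h1
  simp only [pairing_lieDer e he (lieDer_mem h _) h, Finset.sum_neg_distrib, neg_eq_zero] at h1
  rw [Finset.sum_eq_zero_iff_of_nonneg fun a _ => pairing_self_nonneg _ _] at h1
  exact isAdInvariant_of_forall_basis e h fun a =>
    eq_zero_of_pairing_self_nonpos e (lieDer_mem h _) (h1 a (Finset.mem_univ a)).le

lemma pairing_casimir (e : Module.Basis (Fin n) ℝ L)
    (he : ∀ (x : L) (a b : Fin n), e.repr ⁅x, e a⁆ b = -e.repr ⁅x, e b⁆ a) {η θ : (Fin k → L) → ℝ}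
    (hη : η ∈ altForms L k) (hθ : θ ∈ altForms L k) :
    pairing e (casimir e k η) θ = pairing e η (casimir e k θ) := by
  simp only [casimir_apply, pairing_sum_left, pairing_sum_right]
  refine Finset.sum_congr rfl fun a _ => ?_
  rw [pairing_lieDer e he (lieDer_mem hη _) hθ, pairing_lieDer e he hη (lieDer_mem hθ _), neg_neg]

lemma casimir_eq_zero_of_casimir_casimir_eq_zero (e : Module.Basis (Fin n) ℝ L)
    (he : ∀ (x : L) (a b : Fin n), e.repr ⁅x, e a⁆ b = -e.repr ⁅x, e b⁆ a) {η : (Fin k → L) → ℝ}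
    (h : η ∈ altForms L k) (h0 : casimir e k (casimir e k η) = 0) : casimir e k η = 0 := by
  refine eq_zero_of_pairing_self_nonpos e (casimir_mem _ h) ?_
  rw [pairing_casimir e he h (casimir_mem _ h), h0]
  simp [pairing]

lemma exists_eq_add_casimir [FiniteDimensional ℝ L] (e : Module.Basis (Fin n) ℝ L)
    (he : ∀ (x : L) (a b : Fin n), e.repr ⁅x, e a⁆ b = -e.repr ⁅x, e b⁆ a) {η : (Fin k → L) → ℝ}
    (h : η ∈ altForms L k) :
    ∃ γ ∈ altForms L k, IsAdInvariant k γ ∧ ∃ θ ∈ altForms L k, η = γ + casimir e k θ := by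
  let C : altForms L k →ₗ[ℝ] altForms L k := (casimir e k).restrict fun _ => casimir_mem e
  have hdisj : Disjoint C.ker C.range := by
    rw [Submodule.disjoint_def]
    rintro _ hx ⟨θ, rfl⟩
    exact Subtype.ext (casimir_eq_zero_of_casimir_casimir_eq_zero e he θ.2
      (congrArg Subtype.val (LinearMap.mem_ker.1 hx)))
  have htop : C.ker ⊔ C.range = ⊤ := by
    refine Submodule.eq_top_of_disjoint _ _ ?_ hdisj
    rw [add_comm, LinearMap.finrank_range_add_finrank_ker]
  obtain ⟨γ, hγ, _, ⟨θ, rfl⟩, hsum⟩ :=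
    Submodule.mem_sup.1 (htop ▸ Submodule.mem_top : (⟨η, h⟩ : altForms L k) ∈ C.ker ⊔ C.range)
  exact ⟨γ, γ.2, isAdInvariant_of_casimir_eq_zero e he γ.2
    (congrArg Subtype.val (LinearMap.mem_ker.1 hγ)), θ, θ.2, (congrArg Subtype.val hsum).symm⟩

lemma dLin_casimir (e : Fin n → L) {η : (Fin k → L) → ℝ} (h : η ∈ altForms L k) :
    dLin L k (casimir e k η) = casimir e (k + 1) (dLin L k η) := by
  simp only [casimir_apply, map_sum]
  exact Finset.sum_congr rfl fun a _ => by rw [dLin_lieDer (lieDer_mem h _), dLin_lieDer h]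

lemma IsAdInvariant.dLin {η : (Fin k → L) → ℝ} (h : η ∈ altForms L k) (hη : IsAdInvariant k η) :
    IsAdInvariant (k + 1) (dLin L k η) := fun x => by
  change lieDer (k + 1) x _ = 0
  rw [← dLin_lieDer h, show lieDer k x η = 0 from hη x, map_zero]

lemma casimir_eq_dLin (e : Fin n → L) {θ : (Fin (k + 1) → L) → ℝ} (h : θ ∈ altForms L (k + 1))
    (hθ : IsAdInvariant (k + 2) (dLin L (k + 1) θ)) :
    casimir e (k + 1) θ = dLin L k (∑ a, lieDer k (e a) (contr k (e a) θ)) := by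
  rw [casimir_apply, map_sum]
  refine Finset.sum_congr rfl fun a _ => ?_
  have h0 : contr (k + 1) (e a) (lieDer (k + 2) (e a) (dLin L (k + 1) θ)) = 0 := by
    rw [show lieDer (k + 2) (e a) _ = 0 from hθ (e a), map_zero]
  rw [contr_self_lieDer_self _ _ (dLin_mem h), contr_dLin h, map_sub, sub_eq_zero] at h0
  rw [h0, dLin_lieDer (contr_mem h _)]

end Casimir

/-- Let `𝔤` be a finite-dimensional real Lie algebra of compact type.
Then the inclusion of the subcomplex of `ad*`-invariant forms into the full
Chevalley–Eilenberg complex is a quasi-isomorphism (stated elementwise: surjectivity on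
cohomology in every degree, and injectivity on cohomology); in particular `H•(𝔤)` is
computed by the subcomplex of `ad*`-invariant forms. -/
theorem invariant_CE_subcomplex_quasiIso
    (L : Type*) [LieRing L] [LieAlgebra ℝ L] [FiniteDimensional ℝ L]
    (hct : IsCompactType L) :
    -- surjectivity on cohomology in degree 0 (cohomologous in degree 0 means equal)
    (∀ η : (Fin 0 → L) → ℝ, IsAltML 0 η → dCE 0 η = 0 →
      ∃ γ : (Fin 0 → L) → ℝ, IsAltML 0 γ ∧ IsAdInvariant 0 γ ∧ dCE 0 γ = 0 ∧ γ = η) ∧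
    -- surjectivity on cohomology in positive degrees
    (∀ (k : ℕ) (η : (Fin (k + 1) → L) → ℝ), IsAltML (k + 1) η → dCE (k + 1) η = 0 →
      ∃ γ : (Fin (k + 1) → L) → ℝ, IsAltML (k + 1) γ ∧ IsAdInvariant (k + 1) γ ∧
        dCE (k + 1) γ = 0 ∧ ∃ β : (Fin k → L) → ℝ, IsAltML k β ∧ η - γ = dCE k β) ∧
    -- injectivity on cohomology: an invariant cocycle which is exact in the full complex
    -- is already exact in the invariant subcomplex
    (∀ (k : ℕ) (γ : (Fin (k + 1) → L) → ℝ), IsAltML (k + 1) γ → IsAdInvariant (k + 1) γ →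
      (∃ β : (Fin k → L) → ℝ, IsAltML k β ∧ γ = dCE k β) →
      ∃ β' : (Fin k → L) → ℝ, IsAltML k β' ∧ IsAdInvariant k β' ∧ γ = dCE k β') := by
  obtain ⟨n, e, he⟩ := IsCompactType.exists_basis hct
  refine ⟨fun η h h0 => ⟨η, h, fun x => lieDer_zero_deg x η, h0, rfl⟩, ?_, ?_⟩
  · intro k η h h0
    obtain ⟨γ, hγ, hγinv, θ, hθ, rfl⟩ := exists_eq_add_casimir e he h
    change dLin L (k + 1) _ = 0 at h0
    rw [map_add, dLin_casimir e hθ] at h0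
    have hC := congrArg (casimir e (k + 2)) h0
    rw [map_add, (hγinv.dLin hγ).casimir_eq_zero, zero_add, map_zero] at hC
    have hCθ := casimir_eq_zero_of_casimir_casimir_eq_zero e he (dLin_mem hθ) hC
    rw [hCθ, add_zero] at h0
    refine ⟨γ, hγ, hγinv, h0, ∑ a, lieDer k (e a) (contr k (e a) θ),
      mem_altForms.1 (sum_mem fun a _ => lieDer_mem (contr_mem hθ _) _), ?_⟩
    rw [add_sub_cancel_left]
    exact casimir_eq_dLin e hθ (isAdInvariant_of_casimir_eq_zero e he (dLin_mem hθ) hCθ)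
  · rintro k γ hγ hγinv ⟨β, hβ, rfl⟩
    obtain ⟨β', hβ', hinv, θ, hθ, rfl⟩ := exists_eq_add_casimir e he hβ
    refine ⟨β', hβ', hinv, ?_⟩
    change dLin L k _ = dLin L k _
    have hC : casimir e (k + 1) (dLin L k (β' + casimir e k θ)) = 0 := hγinv.casimir_eq_zero
    rw [map_add, map_add, (hinv.dLin hβ').casimir_eq_zero, zero_add, dLin_casimir e hθ] at hC
    rw [map_add, dLin_casimir e hθ,
      casimir_eq_zero_of_casimir_casimir_eq_zero e he (dLin_mem hθ) hC, add_zero]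

end Paper
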